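/- arXiv:2011.03220 — 2 statements merged into one kernel-verified Lean document; each statement's English description precedes it below -/
import Mathlib

section
/- Let 1 < p ≤ 2. There is a constant C = C(p) > 0 such that for every n ≥ 1 and every smooth compactly supported function φ : ℝⁿ → ℝ, the multiplicative interpolation inequality ‖∇φ‖_{L^p} ≤ C ‖φ‖_{L^p}^{1/2} ‖Δφ‖_{L^p}^{1/2} holds. -/
open MeasureTheory

/-- Partial derivative `∂ᵢ u` of a function on `ℝⁿ = EuclideanSpace ℝ (Fin n)`. -/
noncomputable def pd {n : ℕ} (u : EuclideanSpace ℝ (Fin n) → ℝ) (i : Fin n)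
    (x : EuclideanSpace ℝ (Fin n)) : ℝ :=
  fderiv ℝ u x (EuclideanSpace.single i 1)

/-- Second partial derivative `∂ᵢ∂ⱼ u`. -/
noncomputable def pd2 {n : ℕ} (u : EuclideanSpace ℝ (Fin n) → ℝ) (i j : Fin n)
    (x : EuclideanSpace ℝ (Fin n)) : ℝ :=
  pd (pd u j) i x

/-- Laplacian `Δu = ∑ᵢ ∂ᵢ² u`. -/
noncomputable def lap {n : ℕ} (u : EuclideanSpace ℝ (Fin n) → ℝ)
    (x : EuclideanSpace ℝ (Fin n)) : ℝ :=
  ∑ i : Fin n, pd2 u i i x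

/-- Euclidean norm of the gradient, `|∇u|(x) = (∑ᵢ (∂ᵢu)²)^{1/2}`. -/
noncomputable def gradNorm {n : ℕ} (u : EuclideanSpace ℝ (Fin n) → ℝ)
    (x : EuclideanSpace ℝ (Fin n)) : ℝ :=
  Real.sqrt (∑ i : Fin n, pd u i x ^ 2)

/-- Hilbert–Schmidt norm of the Hessian, `|Hess u|(x) = (∑_{i,j} (∂ᵢ∂ⱼu)²)^{1/2}`. -/
noncomputable def hessNorm {n : ℕ} (u : EuclideanSpace ℝ (Fin n) → ℝ)
    (x : EuclideanSpace ℝ (Fin n)) : ℝ :=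
  Real.sqrt (∑ i : Fin n, ∑ j : Fin n, pd2 u i j x ^ 2)

/-- `L^p` norm with respect to Lebesgue measure on `ℝⁿ`:  `(∫ |f|^p)^{1/p}`. -/
noncomputable def lpNorm {n : ℕ} (p : ℝ) (f : EuclideanSpace ℝ (Fin n) → ℝ) : ℝ :=
  (∫ x, |f x| ^ p) ^ (1 / p)

lemma holder_aux {α : Type*} [MeasurableSpace α] (μ : Measure α) (A B : α → ℝ) (a : ℝ)
    (ha0 : 0 < a) (ha1 : a ≤ 1) (hA : Integrable A μ) (hB : Integrable B μ)
    (hA0 : ∀ x, 0 ≤ A x) (hB0 : ∀ x, 0 ≤ B x) :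
    ∫ x, A x ^ a * B x ^ (1 - a) ∂μ ≤ (∫ x, A x ∂μ) ^ a * (∫ x, B x ∂μ) ^ (1 - a) := by
  rcases ha1.eq_or_lt with rfl | ha1
  · simp
  have key : ∀ (F : α → ℝ) (b : ℝ), 0 < b → Integrable F μ → (∀ x, 0 ≤ F x) →
      MemLp (fun x => F x ^ b) (ENNReal.ofReal (1 / b)) μ := by
    intro F b hb hF hF0
    have h := (memLp_one_iff_integrable.2 hF).norm_rpow_div (ENNReal.ofReal b)
    rw [ENNReal.toReal_ofReal hb.le] at h
    rw [ENNReal.ofReal_div_of_pos hb, ENNReal.ofReal_one]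
    refine h.congr_norm ?_ ?_ 
    · exact (hF.aestronglyMeasurable.aemeasurable.pow_const b).aestronglyMeasurable
    · exact Filter.Eventually.of_forall fun x => by simp [abs_of_nonneg (hF0 x)]
  have hb : 0 < 1 - a := by linarith
  have hc : (1 / a).HolderConjugate (1 / (1 - a)) := by
    rw [Real.holderConjugate_iff]
    refine ⟨by rw [lt_div_iff₀ ha0]; linarith, by simp⟩
  have h := integral_mul_le_Lp_mul_Lq_of_nonneg (μ := μ) hc
    (f := fun x => A x ^ a) (g := fun x => B x ^ (1 - a))
    (Filter.Eventually.of_forall fun x => Real.rpow_nonneg (hA0 x) _)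
    (Filter.Eventually.of_forall fun x => Real.rpow_nonneg (hB0 x) _)
    (key A a ha0 hA hA0) (key B (1 - a) hb hB hB0)
  have e1 : ∀ x, (A x ^ a) ^ (1 / a) = A x := fun x => by
    rw [← Real.rpow_mul (hA0 x), mul_one_div_cancel ha0.ne', Real.rpow_one]
  have e2 : ∀ x, (B x ^ (1 - a)) ^ (1 / (1 - a)) = B x := fun x => by
    rw [← Real.rpow_mul (hB0 x), mul_one_div_cancel hb.ne', Real.rpow_one]
  simpa only [e1, e2, one_div_one_div] using h

lemma G_deriv (p ε : ℝ) (hε : 0 < ε) (t : ℝ) :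
    HasDerivAt (fun t : ℝ => t * (t ^ 2 + ε) ^ ((p - 2) / 2))
      ((t ^ 2 + ε) ^ ((p - 2) / 2) + (p - 2) * t ^ 2 * (t ^ 2 + ε) ^ ((p - 2) / 2 - 1)) t := by
  have h0 : t ^ 2 + ε ≠ 0 := by positivity
  have h1 : HasDerivAt (fun t : ℝ => t ^ 2 + ε) (2 * t) t := by
    simpa using (hasDerivAt_pow 2 t).add_const ε
  have h2 := (hasDerivAt_id t).mul (h1.rpow_const (p := (p - 2) / 2) (Or.inl h0))
  refine h2.congr_deriv ?_
  simp only [id]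
  ring

lemma G_deriv_ge (p ε : ℝ) (hp2 : p ≤ 2) (hε : 0 < ε) (t : ℝ) :
    (p - 1) * (t ^ 2 + ε) ^ ((p - 2) / 2) ≤
      (t ^ 2 + ε) ^ ((p - 2) / 2) + (p - 2) * t ^ 2 * (t ^ 2 + ε) ^ ((p - 2) / 2 - 1) := by
  have h0 : 0 < t ^ 2 + ε := by positivity
  have hw : (t ^ 2 + ε) ^ ((p - 2) / 2) = (t ^ 2 + ε) ^ ((p - 2) / 2 - 1) * (t ^ 2 + ε) := by
    rw [Real.rpow_sub_one h0.ne']; field_simp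
  have hz : 0 < (t ^ 2 + ε) ^ ((p - 2) / 2 - 1) := Real.rpow_pos_of_pos h0 _
  rw [hw]
  nlinarith [mul_nonneg (mul_nonneg hz.le hε.le) (sub_nonneg.2 hp2)]

lemma sq_rpow_half (t s : ℝ) : (t ^ 2) ^ (s / 2) = |t| ^ s := by
  rw [← sq_abs, ← Real.rpow_natCast, ← Real.rpow_mul (abs_nonneg t)]
  congr 1; push_cast; ring

lemma G_abs_le (p ε : ℝ) (hp1 : 1 < p) (hp2 : p ≤ 2) (hε : 0 < ε) (t : ℝ) :
    |t * (t ^ 2 + ε) ^ ((p - 2) / 2)| ≤ |t| ^ (p - 1) := by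
  rcases eq_or_ne t 0 with rfl | ht
  · simp; exact Real.rpow_nonneg le_rfl _
  have ht' : 0 < |t| := abs_pos.2 ht
  rw [abs_mul, abs_of_nonneg (Real.rpow_nonneg (by positivity : (0:ℝ) ≤ t ^ 2 + ε) _)]
  have h : (t ^ 2 + ε) ^ ((p - 2) / 2) ≤ |t| ^ (p - 2) := by
    rw [← sq_rpow_half]
    exact Real.rpow_le_rpow_of_nonpos (by positivity) (by linarith) (by linarith)
  calc |t| * (t ^ 2 + ε) ^ ((p - 2) / 2) ≤ |t| * |t| ^ (p - 2) := by gcongr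
    _ = |t| ^ (p - 1) := by
      rw [show p - 1 = 1 + (p - 2) by ring, Real.rpow_add ht', Real.rpow_one]

section
variable {n : ℕ} {φ : EuclideanSpace ℝ (Fin n) → ℝ}

lemma pd_smooth (h : ContDiff ℝ (⊤ : ℕ∞) φ) (i : Fin n) : ContDiff ℝ (⊤ : ℕ∞) (pd φ i) :=
  (h.fderiv_right (m := (⊤ : ℕ∞)) (by simp)).clm_apply contDiff_const

lemma pd_supp (h : HasCompactSupport φ) (i : Fin n) : HasCompactSupport (pd φ i) :=
  h.fderiv_apply ℝ _

lemma pd_zero {x : EuclideanSpace ℝ (Fin n)} (hx : x ∉ tsupport φ) (i : Fin n) :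
    pd φ i x = 0 := by
  simp [pd, fderiv_of_notMem_tsupport ℝ hx]

lemma pd2_zero {x : EuclideanSpace ℝ (Fin n)} (hx : x ∉ tsupport φ) (i j : Fin n) :
    pd2 φ i j x = 0 :=
  pd_zero (fun h => hx (tsupport_fderiv_apply_subset ℝ _ h)) i

lemma integrable_aux {f : EuclideanSpace ℝ (Fin n) → ℝ} (hs : HasCompactSupport φ)
    (hf : Continuous f) (h0 : ∀ x, x ∉ tsupport φ → f x = 0) : Integrable f :=
  hf.integrable_of_hasCompactSupport (HasCompactSupport.intro hs h0)

/-- Integration by parts with the truncated power. -/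
lemma energy (p ε : ℝ) (hp1 : 1 < p) (hp2 : p ≤ 2) (hε : 0 < ε)
    (h : ContDiff ℝ (⊤ : ℕ∞) φ) (hs : HasCompactSupport φ) :
    (p - 1) * ∫ x, gradNorm φ x ^ 2 * (φ x ^ 2 + ε) ^ ((p - 2) / 2) ≤
      ∫ x, |lap φ x| * |φ x| ^ (p - 1) := by
  have hφc := h.continuous
  have hpc : ∀ i, Continuous (pd φ i) := fun i => (pd_smooth h i).continuous
  have hp2c : ∀ i j, Continuous (pd2 φ i j) := fun i j => (pd_smooth (pd_smooth h j) i).continuous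
  have hlc : Continuous (lap φ) := by
    unfold lap; exact continuous_finset_sum _ fun i _ => hp2c i i
  have hl0 : ∀ x, x ∉ tsupport φ → lap φ x = 0 := fun x hx => by simp [lap, pd2_zero hx]
  have hb : ∀ x, φ x ^ 2 + ε ≠ 0 := fun x => by positivity
  have hwc : ∀ s : ℝ, Continuous fun x => (φ x ^ 2 + ε) ^ s := fun s =>
    ((hφc.pow 2).add continuous_const).rpow_const fun x => Or.inl (hb x)
  set g : EuclideanSpace ℝ (Fin n) → ℝ := fun x => φ x * (φ x ^ 2 + ε) ^ ((p - 2) / 2) with hg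
  set d : EuclideanSpace ℝ (Fin n) → ℝ := fun x => (φ x ^ 2 + ε) ^ ((p - 2) / 2) +
    (p - 2) * φ x ^ 2 * (φ x ^ 2 + ε) ^ ((p - 2) / 2 - 1) with hd
  have hgc : Continuous g := hφc.mul (hwc _)
  have hdc : Continuous d :=
    (hwc _).add ((continuous_const.mul (hφc.pow 2)).mul (hwc _))
  have hgd : ∀ x, HasFDerivAt g (d x • fderiv ℝ φ x) x := fun x =>
    (G_deriv p ε hε (φ x)).comp_hasFDerivAt x (h.differentiable (by simp) x).hasFDerivAt
  have hgi : ∀ i x, fderiv ℝ g x (EuclideanSpace.single i 1) = d x * pd φ i x := fun i x => by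
    rw [(hgd x).fderiv]; simp [pd]
  have ibp : ∀ i, ∫ x, g x * pd2 φ i i x = - ∫ x, d x * pd φ i x ^ 2 := by
    intro i
    have := integral_mul_fderiv_eq_neg_fderiv_mul_of_integrable
      (μ := (volume : Measure (EuclideanSpace ℝ (Fin n)))) (f := g) (g := pd φ i)
      (v := EuclideanSpace.single i 1) ?_ ?_ ?_ ?_ ?_
    · simp only [hgi] at this
      simp only [pow_two, ← mul_assoc]
      exact this
    · simp only [hgi]
      exact integrable_aux hs ((hdc.mul (hpc i)).mul (hpc i)) fun x hx => by simp [pd_zero hx]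
    · exact integrable_aux hs (hgc.mul (hp2c i i)) fun x hx => by
        have := pd2_zero hx i i
        simp only [pd2] at this
        rw [pd] at this
        rw [this, mul_zero]
    · exact integrable_aux hs (hgc.mul (hpc i)) fun x hx => by simp [pd_zero hx]
    · exact fun x _ => (hgd x).differentiableAt
    · exact fun x _ => (pd_smooth h i).differentiable (by simp) x
  have hgn : ∀ x, gradNorm φ x ^ 2 = ∑ i, pd φ i x ^ 2 := fun x =>
    Real.sq_sqrt (Finset.sum_nonneg fun i _ => sq_nonneg _)
  have hint : ∀ i, Integrable fun x => d x * pd φ i x ^ 2 := fun i =>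
    integrable_aux hs (hdc.mul ((hpc i).pow 2)) fun x hx => by simp [pd_zero hx]
  have hint2 : ∀ i, Integrable fun x => g x * pd2 φ i i x := fun i =>
    integrable_aux hs (hgc.mul (hp2c i i)) fun x hx => by simp [pd2_zero hx]
  have tot : ∫ x, g x * lap φ x = - ∫ x, d x * gradNorm φ x ^ 2 := by
    simp only [hgn, lap, Finset.mul_sum]
    rw [integral_finset_sum _ fun i _ => hint2 i, integral_finset_sum _ fun i _ => hint i,
      ← Finset.sum_neg_distrib]
    exact Finset.sum_congr rfl fun i _ => ibp i
  have hsumc : Continuous fun x => ∑ i, pd φ i x ^ 2 :=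
    continuous_finset_sum _ fun i _ => (hpc i).pow 2
  calc (p - 1) * ∫ x, gradNorm φ x ^ 2 * (φ x ^ 2 + ε) ^ ((p - 2) / 2)
      = ∫ x, (p - 1) * (gradNorm φ x ^ 2 * (φ x ^ 2 + ε) ^ ((p - 2) / 2)) :=
        (integral_const_mul _ _).symm
    _ ≤ ∫ x, d x * gradNorm φ x ^ 2 := by
      simp only [hgn]
      refine integral_mono ?_ ?_ fun x => ?_
      · exact integrable_aux hs (continuous_const.mul (hsumc.mul (hwc _)))
          fun x hx => by simp [pd_zero hx]
      · exact integrable_aux hs (hdc.mul hsumc) fun x hx => by simp [pd_zero hx]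
      · have := mul_le_mul_of_nonneg_right (G_deriv_ge p ε hp2 hε (φ x))
          (Finset.sum_nonneg fun i _ => sq_nonneg (pd φ i x) : 0 ≤ ∑ i, pd φ i x ^ 2)
        simp only [hd]
        linarith
    _ = ∫ x, - (g x * lap φ x) := by rw [integral_neg, tot, neg_neg]
    _ ≤ ∫ x, |lap φ x| * |φ x| ^ (p - 1) := by
      refine integral_mono ?_ ?_ fun x => ?_
      · exact integrable_aux hs (hgc.mul hlc).neg fun x hx => by simp [hl0 x hx]
      · exact integrable_aux hs (hlc.abs.mul
          (hφc.abs.rpow_const fun x => Or.inr (by linarith))) fun x hx => by simp [hl0 x hx]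
      · calc -(g x * lap φ x) ≤ |g x * lap φ x| := neg_le_abs _
          _ = |lap φ x| * |g x| := by rw [abs_mul, mul_comm]
          _ ≤ _ := mul_le_mul_of_nonneg_left (G_abs_le p ε hp1 hp2 hε _) (abs_nonneg _)

lemma final_bound (p : ℝ) (hp1 : 1 < p) (hp2 : p ≤ 2)
    (h : ContDiff ℝ (⊤ : ℕ∞) φ) (hs : HasCompactSupport φ) :
    ∫ x, |gradNorm φ x| ^ p ≤ ((p - 1)⁻¹ * ((∫ x, |lap φ x| ^ p) ^ (1 / p) *
      (∫ x, |φ x| ^ p) ^ (1 - 1 / p))) ^ (p / 2) * (∫ x, |φ x| ^ p) ^ (1 - p / 2) := by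
  have hφc := h.continuous
  have hpc : ∀ i, Continuous (pd φ i) := fun i => (pd_smooth h i).continuous
  have hp2c : ∀ i j, Continuous (pd2 φ i j) := fun i j => (pd_smooth (pd_smooth h j) i).continuous
  have hlc : Continuous (lap φ) := by
    unfold lap; exact continuous_finset_sum _ fun i _ => hp2c i i
  have hl0 : ∀ x, x ∉ tsupport φ → lap φ x = 0 := fun x hx => by simp [lap, pd2_zero hx]
  have hGc : Continuous (gradNorm φ) :=
    (continuous_finset_sum _ fun i _ => (hpc i).pow 2).sqrt
  have hG0 : ∀ x, x ∉ tsupport φ → gradNorm φ x = 0 := fun x hx => by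
    simp [gradNorm, pd_zero hx]
  have hf0 : ∀ x, x ∉ tsupport φ → φ x = 0 := fun x hx => image_eq_zero_of_notMem_tsupport hx
  have hp0 : 0 < p := by linarith
  have hNint : Integrable fun x => |φ x| ^ p :=
    integrable_aux hs (hφc.abs.rpow_const fun x => Or.inr hp0.le)
      fun x hx => by simp [hf0 x hx, hp0.ne']
  have hDint : Integrable fun x => |lap φ x| ^ p :=
    integrable_aux hs (hlc.abs.rpow_const fun x => Or.inr hp0.le)
      fun x hx => by simp [hl0 x hx, hp0.ne']
  have hold1 : ∫ x, |lap φ x| * |φ x| ^ (p - 1) ≤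
      (∫ x, |lap φ x| ^ p) ^ (1 / p) * (∫ x, |φ x| ^ p) ^ (1 - 1 / p) := by
    have := holder_aux volume _ _ (1 / p) (by positivity)
      (by rw [div_le_one hp0]; exact hp1.le) hDint hNint
      (fun x => Real.rpow_nonneg (abs_nonneg _) _) (fun x => Real.rpow_nonneg (abs_nonneg _) _)
    refine le_of_eq_of_le (integral_congr_ae (Filter.Eventually.of_forall fun x => ?_)) this
    simp only
    rw [← Real.rpow_mul (abs_nonneg _), ← Real.rpow_mul (abs_nonneg _),
      mul_one_div_cancel hp0.ne', Real.rpow_one, mul_sub, mul_one_div_cancel hp0.ne', mul_one]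
  set R := (∫ x, |lap φ x| ^ p) ^ (1 / p) * (∫ x, |φ x| ^ p) ^ (1 - 1 / p)
  set N := ∫ x, |φ x| ^ p with hN
  have hN0 : 0 ≤ N := integral_nonneg fun x => Real.rpow_nonneg (abs_nonneg _) _
  set K := tsupport φ
  have hKm : MeasurableSet K := (isClosed_tsupport φ).measurableSet
  have hKf : volume K < ⊤ := hs.measure_lt_top
  set V := (volume K).toReal
  have hVdef : volume.real K = V := rfl
  have step : ∀ ε : ℝ, 0 < ε → ∫ x, |gradNorm φ x| ^ p ≤
      ((p - 1)⁻¹ * R) ^ (p / 2) * (N + ε ^ (p / 2) * V) ^ (1 - p / 2) := by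
    intro ε hε
    have hb : ∀ x, 0 < φ x ^ 2 + ε := fun x => by positivity
    have hwc : ∀ s : ℝ, Continuous fun x => (φ x ^ 2 + ε) ^ s := fun s =>
      ((hφc.pow 2).add continuous_const).rpow_const fun x => Or.inl (hb x).ne'
    have hAint : Integrable fun x => gradNorm φ x ^ 2 * (φ x ^ 2 + ε) ^ ((p - 2) / 2) :=
      integrable_aux hs ((hGc.pow 2).mul (hwc _)) fun x hx => by simp [hG0 x hx]
    have hBint : IntegrableOn (fun x => (φ x ^ 2 + ε) ^ (p / 2)) K :=
      (hwc _).continuousOn.integrableOn_compact hs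
    have hA0 : ∀ x, 0 ≤ gradNorm φ x ^ 2 * (φ x ^ 2 + ε) ^ ((p - 2) / 2) := fun x =>
      mul_nonneg (sq_nonneg _) (Real.rpow_nonneg (hb x).le _)
    have hB0 : ∀ x, 0 ≤ (φ x ^ 2 + ε) ^ (p / 2) := fun x => Real.rpow_nonneg (hb x).le _
    have hh := holder_aux (volume.restrict K) _ _ (p / 2) (by positivity) (by linarith)
      hAint.integrableOn hBint hA0 hB0
    have eL : ∫ x, |gradNorm φ x| ^ p = ∫ x in K,
        (gradNorm φ x ^ 2 * (φ x ^ 2 + ε) ^ ((p - 2) / 2)) ^ (p / 2) *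
          ((φ x ^ 2 + ε) ^ (p / 2)) ^ (1 - p / 2) := by
      rw [← setIntegral_eq_integral_of_forall_compl_eq_zero (s := K)
        (fun x hx => by simp [hG0 x hx, hp0.ne'])]
      refine integral_congr_ae (Filter.Eventually.of_forall fun x => ?_)
      simp only
      rw [Real.mul_rpow (sq_nonneg _) (Real.rpow_nonneg (hb x).le _), sq_rpow_half,
        ← Real.rpow_mul (hb x).le, ← Real.rpow_mul (hb x).le, mul_assoc, ← Real.rpow_add (hb x),
        show (p - 2) / 2 * (p / 2) + p / 2 * (1 - p / 2) = 0 by ring, Real.rpow_zero, mul_one]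
    rw [eL]
    refine hh.trans ?_
    have hAle : ∫ x in K, gradNorm φ x ^ 2 * (φ x ^ 2 + ε) ^ ((p - 2) / 2) ≤ (p - 1)⁻¹ * R := by
      rw [setIntegral_eq_integral_of_forall_compl_eq_zero
        (fun x hx => by simp [hG0 x hx]), inv_mul_eq_div, le_div_iff₀ (by linarith), mul_comm]
      exact (energy p ε hp1 hp2 hε h hs).trans hold1
    have hBle : ∫ x in K, (φ x ^ 2 + ε) ^ (p / 2) ≤ N + ε ^ (p / 2) * V := by
      have hcK : IntegrableOn (fun _ : EuclideanSpace ℝ (Fin n) => ε ^ (p / 2)) K :=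
        continuousOn_const.integrableOn_compact hs
      calc ∫ x in K, (φ x ^ 2 + ε) ^ (p / 2) ≤ ∫ x in K, (|φ x| ^ p + ε ^ (p / 2)) := by
            refine integral_mono hBint (hNint.integrableOn.add hcK) fun x => ?_
            simp only
            rw [← sq_rpow_half]
            exact Real.rpow_add_le_add_rpow (sq_nonneg _) hε.le (by positivity) (by linarith)
        _ = N + ε ^ (p / 2) * V := by
            rw [integral_add hNint.integrableOn hcK,
              setIntegral_eq_integral_of_forall_compl_eq_zero
                (fun x hx => by simp [hf0 x hx, hp0.ne'])]
            simp [hVdef, mul_comm, hN]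
    have hI1 : 0 ≤ ∫ x in K, gradNorm φ x ^ 2 * (φ x ^ 2 + ε) ^ ((p - 2) / 2) := integral_nonneg hA0
    have hI2 : 0 ≤ ∫ x in K, (φ x ^ 2 + ε) ^ (p / 2) := integral_nonneg hB0
    exact mul_le_mul (Real.rpow_le_rpow hI1 hAle (by positivity))
      (Real.rpow_le_rpow hI2 hBle (by linarith)) (Real.rpow_nonneg hI2 _)
      (Real.rpow_nonneg (hI1.trans hAle) _)
  have hcont : Continuous fun ε : ℝ =>
      ((p - 1)⁻¹ * R) ^ (p / 2) * (N + ε ^ (p / 2) * V) ^ (1 - p / 2) := by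
    refine continuous_const.mul (Continuous.rpow_const ?_ fun x => Or.inr (by linarith))
    exact continuous_const.add
      ((Real.continuous_rpow_const (by positivity)).mul continuous_const)
  have ht := (hcont.tendsto 0).mono_left (nhdsWithin_le_nhds (s := Set.Ioi 0))
  have := ge_of_tendsto ht (Filter.eventually_of_mem self_mem_nhdsWithin fun ε hε => step ε hε)
  simpa [Real.zero_rpow (by positivity : p / 2 ≠ 0)] using this

end

/-- Coulhon–Duong multiplicative interpolation inequality for `1 < p ≤ 2`:
there is `C = C(p) > 0` such that `‖∇φ‖_p ≤ C ‖φ‖_p^{1/2} ‖Δφ‖_p^{1/2}`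
for all `n ≥ 1` and `φ ∈ C_c^∞(ℝⁿ)`. -/
theorem multiplicative_interpolation_inequality (p : ℝ) (hp1 : 1 < p) (hp2 : p ≤ 2) :
    ∃ C : ℝ, 0 < C ∧ ∀ n : ℕ, 1 ≤ n →
      ∀ φ : EuclideanSpace ℝ (Fin n) → ℝ,
        ContDiff ℝ (⊤ : ℕ∞) φ → HasCompactSupport φ →
        lpNorm p (gradNorm φ) ≤
          C * lpNorm p φ ^ ((1 : ℝ) / 2) * lpNorm p (lap φ) ^ ((1 : ℝ) / 2) := by
  have hp0 : 0 < p := by linarith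
  have hc : 0 < (p - 1)⁻¹ := inv_pos.2 (by linarith)
  refine ⟨(p - 1)⁻¹ ^ ((1 : ℝ) / 2), Real.rpow_pos_of_pos hc _, ?_⟩
  intro n _ φ h hs
  have hb := final_bound p hp1 hp2 h hs
  have hG0 : 0 ≤ ∫ x, |gradNorm φ x| ^ p :=
    integral_nonneg fun x => Real.rpow_nonneg (abs_nonneg _) _
  have hN0 : 0 ≤ ∫ x, |φ x| ^ p := integral_nonneg fun x => Real.rpow_nonneg (abs_nonneg _) _
  have hD0 : 0 ≤ ∫ x, |lap φ x| ^ p := integral_nonneg fun x => Real.rpow_nonneg (abs_nonneg _) _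
  unfold _root_.lpNorm
  generalize (∫ x, |gradNorm φ x| ^ p) = G at *
  generalize (∫ x, |φ x| ^ p) = N at *
  generalize (∫ x, |lap φ x| ^ p) = D at *
  have hq : 0 ≤ 1 - 1 / p := by rw [sub_nonneg, div_le_one hp0]; exact hp1.le
  refine (Real.rpow_le_rpow hG0 hb (by positivity)).trans (le_of_eq ?_)
  have a1 := Real.rpow_nonneg hD0 (1 / p)
  have a2 := Real.rpow_nonneg hN0 (1 - 1 / p)
  rw [Real.mul_rpow (by positivity) (Real.rpow_nonneg hN0 _), ← Real.rpow_mul (by positivity),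
    show p / 2 * (1 / p) = 1 / 2 by field_simp, Real.mul_rpow hc.le (by positivity),
    Real.mul_rpow a1 a2, ← Real.rpow_mul hN0 (1 - 1 / p), ← Real.rpow_mul hN0 (1 - p / 2),
    mul_assoc, mul_assoc, mul_assoc, ← Real.rpow_add_of_nonneg hN0
      (by positivity) (mul_nonneg (by linarith) (by positivity)), ← Real.rpow_mul hN0 (1 / p),
    show (1 - 1 / p) * (1 / 2) + (1 - p / 2) * (1 / p) = 1 / p * (1 / 2) by field_simp; ring]
  ring
end

section
/- Let 2 ≤ p < ∞. There is a constant C = C(p) > 0 such that for every n ≥ 1 and every smooth compactly supported function u : ℝⁿ → ℝ one has ‖∇u‖_{L^p}² ≤ C ‖u‖_{L^p} ( ‖Δu‖_{L^p} + (p−2) ‖Hess u‖_{L^p} ). -/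
open MeasureTheory

lemma aux_pd_smooth {n : ℕ} {u : EuclideanSpace ℝ (Fin n) → ℝ} (hu : ContDiff ℝ (⊤ : ℕ∞) u)
    (i : Fin n) : ContDiff ℝ (⊤ : ℕ∞) (pd u i) := by
  unfold pd
  exact (hu.fderiv_right (m := (⊤ : ℕ∞)) (by simp)).clm_apply contDiff_const

lemma aux_pd_supp {n : ℕ} {u : EuclideanSpace ℝ (Fin n) → ℝ} (hu : HasCompactSupport u)
    (i : Fin n) : HasCompactSupport (pd u i) := by
  unfold pd
  exact hu.fderiv_apply ℝ _

lemma aux_lap_cont {n : ℕ} {u : EuclideanSpace ℝ (Fin n) → ℝ} (hu : ContDiff ℝ (⊤ : ℕ∞) u) :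
    Continuous (lap u) := by
  unfold lap
  exact continuous_finsetSum _ fun i _ => (aux_pd_smooth (aux_pd_smooth hu i) i).continuous

lemma aux_hess_cont {n : ℕ} {u : EuclideanSpace ℝ (Fin n) → ℝ} (hu : ContDiff ℝ (⊤ : ℕ∞) u) :
    Continuous (hessNorm u) := by
  unfold hessNorm
  exact (continuous_finsetSum _ fun i _ => continuous_finsetSum _ fun j _ =>
    (aux_pd_smooth (aux_pd_smooth hu j) i).continuous.pow 2).sqrt

lemma aux_grad_cont {n : ℕ} {u : EuclideanSpace ℝ (Fin n) → ℝ} (hu : ContDiff ℝ (⊤ : ℕ∞) u) :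
    Continuous (gradNorm u) := by
  unfold gradNorm
  exact (continuous_finsetSum _ fun i _ => (aux_pd_smooth hu i).continuous.pow 2).sqrt

lemma aux_zero {n : ℕ} {u : EuclideanSpace ℝ (Fin n) → ℝ} {x : EuclideanSpace ℝ (Fin n)}
    (hx : x ∉ tsupport u) (i : Fin n) : x ∉ tsupport (pd u i) := by
  unfold pd
  intro h
  exact hx (tsupport_fderiv_apply_subset ℝ _ h)

lemma aux_lap_supp {n : ℕ} {u : EuclideanSpace ℝ (Fin n) → ℝ} (hu : HasCompactSupport u) :
    HasCompactSupport (lap u) := by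
  refine HasCompactSupport.intro (K := tsupport u) hu fun x hx => ?_
  unfold lap
  exact Finset.sum_eq_zero fun i _ => image_eq_zero_of_notMem_tsupport (aux_zero (aux_zero hx i) i)

lemma aux_hess_supp {n : ℕ} {u : EuclideanSpace ℝ (Fin n) → ℝ} (hu : HasCompactSupport u) :
    HasCompactSupport (hessNorm u) := by
  refine HasCompactSupport.intro (K := tsupport u) hu fun x hx => ?_
  unfold hessNorm
  have : ∀ i j, pd2 u i j x = 0 := fun i j =>
    image_eq_zero_of_notMem_tsupport (aux_zero (aux_zero hx j) i)
  simp [this]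

lemma aux_grad_supp {n : ℕ} {u : EuclideanSpace ℝ (Fin n) → ℝ} (hu : HasCompactSupport u) :
    HasCompactSupport (gradNorm u) := by
  refine HasCompactSupport.intro (K := tsupport u) hu fun x hx => ?_
  unfold gradNorm
  have : ∀ i, pd u i x = 0 := fun i => image_eq_zero_of_notMem_tsupport (aux_zero hx i)
  simp [this]

/-- the squared gradient -/
noncomputable def gsq {n : ℕ} (u : EuclideanSpace ℝ (Fin n) → ℝ)
    (x : EuclideanSpace ℝ (Fin n)) : ℝ := ∑ i : Fin n, pd u i x ^ 2

lemma gsq_nonneg {n : ℕ} (u : EuclideanSpace ℝ (Fin n) → ℝ) (x) : 0 ≤ gsq u x :=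
  Finset.sum_nonneg fun i _ => sq_nonneg _

lemma gsq_smooth {n : ℕ} {u : EuclideanSpace ℝ (Fin n) → ℝ} (hu : ContDiff ℝ (⊤ : ℕ∞) u) :
    ContDiff ℝ (⊤ : ℕ∞) (gsq u) := by
  unfold gsq
  exact ContDiff.sum fun i _ => (aux_pd_smooth hu i).pow 2

lemma gsq_supp {n : ℕ} {u : EuclideanSpace ℝ (Fin n) → ℝ} (hu : HasCompactSupport u) :
    HasCompactSupport (gsq u) := by
  refine HasCompactSupport.intro (K := tsupport u) hu fun x hx => ?_
  unfold gsq
  have : ∀ i, pd u i x = 0 := fun i => image_eq_zero_of_notMem_tsupport (aux_zero hx i)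
  simp [this]

lemma aux_w_smooth {n : ℕ} {u : EuclideanSpace ℝ (Fin n) → ℝ} (hu : ContDiff ℝ (⊤ : ℕ∞) u)
    (r ε : ℝ) (hε : 0 < ε) : ContDiff ℝ (⊤ : ℕ∞) (fun x => (gsq u x + ε) ^ r) :=
  ((gsq_smooth hu).add contDiff_const).rpow_const_of_ne
    fun x => (add_pos_of_nonneg_of_pos (gsq_nonneg u x) hε).ne'

lemma aux_pd_flux {n : ℕ} {u : EuclideanSpace ℝ (Fin n) → ℝ} (hu : ContDiff ℝ (⊤ : ℕ∞) u)
    (r ε : ℝ) (hε : 0 < ε) (j : Fin n) (x : EuclideanSpace ℝ (Fin n)) :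
    pd (fun x => (gsq u x + ε) ^ r * pd u j x) j x =
      (gsq u x + ε) ^ r * pd2 u j j x +
      2 * r * (gsq u x + ε) ^ (r - 1) * ∑ i, pd u i x * pd u j x * pd2 u j i x := by
  have hd : ∀ i, HasFDerivAt (pd u i) (fderiv ℝ (pd u i) x) x := fun i =>
    ((aux_pd_smooth hu i).differentiable (by simp) x).hasFDerivAt
  have hG : HasFDerivAt (gsq u) (∑ i, (2 * pd u i x) • fderiv ℝ (pd u i) x) x := by
    unfold gsq
    refine HasFDerivAt.fun_sum fun i _ => ?_
    simpa using (hd i).pow 2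
  have hne : gsq u x + ε ≠ 0 := (add_pos_of_nonneg_of_pos (gsq_nonneg u x) hε).ne'
  have hw := (hG.add_const ε).rpow_const (p := r) (Or.inl hne)
  have := hw.mul (hd j)
  unfold pd2
  conv_lhs => unfold pd
  rw [show fderiv ℝ (fun x => (gsq u x + ε) ^ r * fderiv ℝ u x (EuclideanSpace.single j 1)) x = _
    from this.fderiv]
  simp only [ContinuousLinearMap.add_apply, ContinuousLinearMap.smul_apply,
    ContinuousLinearMap.sum_apply, smul_eq_mul, Finset.mul_sum]
  congr 1
  refine Finset.sum_congr rfl fun i _ => ?_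
  rw [show pd (pd u i) j x = fderiv ℝ (pd u i) x (EuclideanSpace.single j 1) from rfl]
  ring

lemma aux_CS {n : ℕ} (u : EuclideanSpace ℝ (Fin n) → ℝ) (x) :
    |∑ j, ∑ i, pd u i x * pd u j x * pd2 u j i x| ≤ gsq u x * hessNorm u x := by
  apply abs_le_of_sq_le_sq
  · have h := Finset.sum_mul_sq_le_sq_mul_sq (Finset.univ : Finset (Fin n × Fin n))
      (fun q => pd u q.2 x * pd u q.1 x) (fun q => pd2 u q.1 q.2 x)
    rw [Fintype.sum_prod_type, Fintype.sum_prod_type, Fintype.sum_prod_type] at h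
    refine h.trans (le_of_eq ?_)
    rw [mul_pow, hessNorm, Real.sq_sqrt (Finset.sum_nonneg fun i _ => Finset.sum_nonneg
      fun j _ => sq_nonneg _)]
    congr 1
    rw [gsq, sq, Finset.sum_mul_sum]
    exact Finset.sum_congr rfl fun i _ => Finset.sum_congr rfl fun j _ => by ring
  · exact mul_nonneg (gsq_nonneg u x) (Real.sqrt_nonneg _)

lemma aux_ibp {n : ℕ} {u : EuclideanSpace ℝ (Fin n) → ℝ} (hu : ContDiff ℝ (⊤ : ℕ∞) u)
    (hs : HasCompactSupport u) (r ε : ℝ) (hr : 0 ≤ r) (hε : 0 < ε) :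
    ∫ x, (gsq u x + ε) ^ r * gsq u x ≤
      ∫ x, |u x| * (gsq u x + ε) ^ r * (|lap u x| + 2 * r * hessNorm u x) := by
  have hF : ∀ j, ContDiff ℝ (⊤ : ℕ∞) (fun x => (gsq u x + ε) ^ r * pd u j x) := fun j =>
    (aux_w_smooth hu r ε hε).mul (aux_pd_smooth hu j)
  have hc : Continuous (fun x => (gsq u x + ε) ^ r) := (aux_w_smooth hu r ε hε).continuous
  have i1 : ∀ j, Integrable (fun x => pd (fun x => (gsq u x + ε) ^ r * pd u j x) j x * u x) :=
    fun j => ((aux_pd_smooth (hF j) j).continuous.mul hu.continuous).integrable_of_hasCompactSupport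
      hs.mul_left
  have i2 : ∀ j, Integrable (fun x => (gsq u x + ε) ^ r * pd u j x * pd u j x) :=
    fun j => ((hF j).continuous.mul (aux_pd_smooth hu j).continuous).integrable_of_hasCompactSupport
      (aux_pd_supp hs j).mul_left
  have i3 : ∀ j, Integrable (fun x => (gsq u x + ε) ^ r * pd u j x * u x) :=
    fun j => ((hF j).continuous.mul hu.continuous).integrable_of_hasCompactSupport
      hs.mul_left
  have key : ∀ j, ∫ x, (gsq u x + ε) ^ r * pd u j x * pd u j x =
      - ∫ x, pd (fun x => (gsq u x + ε) ^ r * pd u j x) j x * u x := fun j =>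
    integral_mul_fderiv_eq_neg_fderiv_mul_of_integrable (i1 j) (i2 j) (i3 j)
      (fun x _ => (hF j).differentiable (by simp) x) (fun x _ => hu.differentiable (by simp) x)
  have e1 : ∫ x, (gsq u x + ε) ^ r * gsq u x =
      ∫ x, ∑ j, (gsq u x + ε) ^ r * pd u j x * pd u j x := by
    congr 1; ext x
    rw [show (gsq u x + ε) ^ r * gsq u x = (gsq u x + ε) ^ r * ∑ i, pd u i x ^ 2 from rfl,
      Finset.mul_sum]
    exact Finset.sum_congr rfl fun i _ => by ring
  rw [e1, integral_finsetSum _ fun j _ => i2 j, Finset.sum_congr rfl fun j _ => key j,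
    Finset.sum_neg_distrib, ← integral_finsetSum _ fun j _ => i1 j, ← integral_neg]
  refine integral_mono (integrable_finsetSum _ fun j _ => i1 j).neg ?_ fun x => ?_
  · refine Continuous.integrable_of_hasCompactSupport ?_ ?_
    · exact (hu.continuous.abs.mul hc).mul
        ((aux_lap_cont hu).abs.add (continuous_const.mul (aux_hess_cont hu)))
    · exact (HasCompactSupport.mul_right (hs.comp_left (g := fun t : ℝ => |t|) abs_zero)).mul_right
  · have hpos : 0 < gsq u x + ε := add_pos_of_nonneg_of_pos (gsq_nonneg u x) hε
    have hCS := aux_CS u x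
    have hh : 0 ≤ hessNorm u x := Real.sqrt_nonneg _
    have hw := Real.rpow_nonneg hpos.le r
    have hw1 := Real.rpow_nonneg hpos.le (r - 1)
    have hw2 : (gsq u x + ε) ^ r = (gsq u x + ε) ^ (r - 1) * (gsq u x + ε) := by
      rw [← Real.rpow_add_one hpos.ne']; simp
    simp only [aux_pd_flux hu r ε hε]
    rw [← Finset.sum_mul, Finset.sum_add_distrib, ← Finset.mul_sum, ← Finset.mul_sum]
    change -(((gsq u x + ε) ^ r * lap u x + _) * u x) ≤ _
    refine (neg_le_abs _).trans ?_
    rw [abs_mul, mul_comm, mul_assoc |u x|]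
    refine mul_le_mul_of_nonneg_left ?_ (abs_nonneg _)
    refine (abs_add_le _ _).trans ?_
    rw [mul_add, abs_mul, abs_of_nonneg hw]
    gcongr
    rw [abs_mul, abs_of_nonneg (by positivity : 0 ≤ 2 * r * (gsq u x + ε) ^ (r - 1))]
    calc _ ≤ 2 * r * (gsq u x + ε) ^ (r - 1) * (gsq u x * hessNorm u x) := by gcongr
      _ ≤ 2 * r * (gsq u x + ε) ^ (r - 1) * ((gsq u x + ε) * hessNorm u x) := by
        gcongr; linarith
      _ = _ := by rw [hw2]; ring

lemma aux_lim {n : ℕ} {u : EuclideanSpace ℝ (Fin n) → ℝ} (hu : ContDiff ℝ (⊤ : ℕ∞) u)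
    (r : ℝ) (hr : 0 ≤ r) {f : EuclideanSpace ℝ (Fin n) → ℝ} (hf : Continuous f)
    (hfs : HasCompactSupport f) :
    Filter.Tendsto (fun ε : ℝ => ∫ x, (gsq u x + ε) ^ r * f x)
      (nhdsWithin 0 (Set.Ioi 0)) (nhds (∫ x, gsq u x ^ r * f x)) := by
  have hGc := (gsq_smooth hu).continuous
  have hc : ∀ ε : ℝ, Continuous (fun x => (gsq u x + ε) ^ r) := fun ε =>
    (hGc.add continuous_const).rpow_const fun x => Or.inr hr
  refine MeasureTheory.tendsto_integral_filter_of_dominated_convergence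
    (fun x => (gsq u x + 1) ^ r * |f x|) ?_ ?_ ?_ ?_
  · exact Filter.Eventually.of_forall fun ε => ((hc ε).mul hf).aestronglyMeasurable
  · filter_upwards [Ioc_mem_nhdsGT (zero_lt_one' ℝ)] with ε hε
    refine Filter.Eventually.of_forall fun x => ?_
    have := gsq_nonneg u x
    have h0 : 0 ≤ gsq u x + ε := by linarith [hε.1]
    rw [Real.norm_eq_abs, abs_mul, abs_of_nonneg (Real.rpow_nonneg h0 r)]
    gcongr
    exact hε.2
  · exact ((hc 1).mul hf.abs).integrable_of_hasCompactSupport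
      (HasCompactSupport.mul_left (hfs.comp_left (g := fun t : ℝ => |t|) abs_zero))
  · refine Filter.Eventually.of_forall fun x => ?_
    have : Continuous (fun ε : ℝ => (gsq u x + ε) ^ r * f x) :=
      ((continuous_const.add continuous_id).rpow_const fun x => Or.inr hr).mul continuous_const
    have h := this.tendsto 0
    simp only [add_zero] at h
    exact h.mono_left nhdsWithin_le_nhds

lemma aux_main {n : ℕ} {u : EuclideanSpace ℝ (Fin n) → ℝ} (hu : ContDiff ℝ (⊤ : ℕ∞) u)
    (hs : HasCompactSupport u) (r : ℝ) (hr : 0 ≤ r) :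
    ∫ x, gsq u x ^ r * gsq u x ≤
      ∫ x, gsq u x ^ r * (|u x| * (|lap u x| + 2 * r * hessNorm u x)) := by
  refine le_of_tendsto_of_tendsto (aux_lim hu r hr (gsq_smooth hu).continuous (gsq_supp hs))
    (aux_lim hu r hr (f := fun x => |u x| * (|lap u x| + 2 * r * hessNorm u x)) ?_ ?_) ?_
  · exact hu.continuous.abs.mul
        ((aux_lap_cont hu).abs.add (continuous_const.mul (aux_hess_cont hu)))
  · exact HasCompactSupport.mul_right (hs.comp_left (g := fun t : ℝ => |t|) abs_zero)
  · filter_upwards [self_mem_nhdsWithin] with ε hε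
    refine (aux_ibp hu hs r ε hr hε).trans (le_of_eq ?_)
    congr 1; ext x; ring

lemma aux_holder {n : ℕ} (p : ℝ) (hp : 2 ≤ p) {f g h : EuclideanSpace ℝ (Fin n) → ℝ}
    (hf : Continuous f) (hfs : HasCompactSupport f) (hg : Continuous g) (hgs : HasCompactSupport g)
    (hh : Continuous h) (hhs : HasCompactSupport h) :
    ∫ x, |g x| ^ (p - 2) * (|f x| * |h x|) ≤ lpNorm p g ^ (p - 2) * (lpNorm p f * lpNorm p h) := by
  have hp0 : 0 < p := by linarith
  have key := ENNReal.lintegral_prod_norm_pow_le (μ := (volume : Measure (EuclideanSpace ℝ (Fin n))))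
    (Finset.univ : Finset (Fin 3))
    (f := ![fun x => ENNReal.ofReal (|g x| ^ p), fun x => ENNReal.ofReal (|f x| ^ p),
      fun x => ENNReal.ofReal (|h x| ^ p)])
    (p := ![(p - 2) / p, 1 / p, 1 / p]) ?_ ?_ ?_
  rotate_left
  · have hm : ∀ k : EuclideanSpace ℝ (Fin n) → ℝ, Continuous k →
        AEMeasurable (fun x => ENNReal.ofReal (|k x| ^ p)) := fun k hk =>
      (ENNReal.continuous_ofReal.comp
        (hk.abs.rpow_const fun x => Or.inr hp0.le)).aemeasurable
    intro i _
    fin_cases i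
    exacts [hm g hg, hm f hf, hm h hh]
  · simp [Fin.sum_univ_three]; field_simp; ring
  · intro i _
    fin_cases i
    · exact div_nonneg (by linarith) hp0.le
    · exact (div_pos one_pos hp0).le
    · exact (div_pos one_pos hp0).le
  have hI : ∀ k : EuclideanSpace ℝ (Fin n) → ℝ, Continuous k → HasCompactSupport k →
      ∫⁻ x, ENNReal.ofReal (|k x| ^ p) = ENNReal.ofReal (∫ x, |k x| ^ p) := fun k hk hks => by
    rw [ofReal_integral_eq_lintegral_ofReal]
    · refine (hk.abs.rpow_const fun x => Or.inr hp0.le).integrable_of_hasCompactSupport ?_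
      exact hks.comp_left (g := fun t : ℝ => |t| ^ p) (by simp [hp0.ne'])
    · exact Filter.Eventually.of_forall fun x => Real.rpow_nonneg (abs_nonneg _) _
  have hJ : ∀ k : EuclideanSpace ℝ (Fin n) → ℝ, 0 ≤ ∫ x, |k x| ^ p := fun k =>
    integral_nonneg fun x => Real.rpow_nonneg (abs_nonneg _) _
  have hp1 : 0 ≤ (p - 2) / p := div_nonneg (by linarith) hp0.le
  have hp2 : 0 ≤ 1 / p := (div_pos one_pos hp0).le
  have hq : ∀ t s : ℝ, 0 ≤ t → (t ^ p) ^ (s / p) = t ^ s := fun t s ht => by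
    rw [← Real.rpow_mul ht]; congr 1; field_simp
  simp only [Fin.prod_univ_three, Matrix.cons_val_zero, Matrix.cons_val_one, Matrix.cons_val] at key
  rw [hI f hf hfs, hI g hg hgs, hI h hh hhs, ENNReal.ofReal_rpow_of_nonneg (hJ g) hp1,
    ENNReal.ofReal_rpow_of_nonneg (hJ f) hp2, ENNReal.ofReal_rpow_of_nonneg (hJ h) hp2,
    ← ENNReal.ofReal_mul (Real.rpow_nonneg (hJ g) _),
    ← ENNReal.ofReal_mul (mul_nonneg (Real.rpow_nonneg (hJ g) _) (Real.rpow_nonneg (hJ f) _))] at key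
  have e : ∀ x, ENNReal.ofReal (|g x| ^ p) ^ ((p - 2) / p) * ENNReal.ofReal (|f x| ^ p) ^ (1 / p) *
      ENNReal.ofReal (|h x| ^ p) ^ (1 / p) =
      ENNReal.ofReal (|g x| ^ (p - 2) * (|f x| * |h x|)) := fun x => by
    have a1 := Real.rpow_nonneg (abs_nonneg (g x)) p
    have a2 := Real.rpow_nonneg (abs_nonneg (f x)) p
    have a3 := Real.rpow_nonneg (abs_nonneg (h x)) p
    rw [ENNReal.ofReal_rpow_of_nonneg a1 hp1, ENNReal.ofReal_rpow_of_nonneg a2 hp2,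
      ENNReal.ofReal_rpow_of_nonneg a3 hp2, hq _ _ (abs_nonneg _), hq _ _ (abs_nonneg _),
      hq _ _ (abs_nonneg _), Real.rpow_one, Real.rpow_one,
      ← ENNReal.ofReal_mul (by positivity), ← ENNReal.ofReal_mul (by positivity), mul_assoc]
  simp only [e] at key
  have hpos : ∀ x, 0 ≤ |g x| ^ (p - 2) * (|f x| * |h x|) := fun x => by positivity
  have hint : Integrable (fun x => |g x| ^ (p - 2) * (|f x| * |h x|)) := by
    refine Continuous.integrable_of_hasCompactSupport
      ((hg.abs.rpow_const fun x => Or.inr (by linarith)).mul (hf.abs.mul hh.abs)) ?_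
    exact HasCompactSupport.mul_left (HasCompactSupport.mul_right
      (hfs.comp_left (g := fun t : ℝ => |t|) abs_zero))
  rw [← ofReal_integral_eq_lintegral_ofReal hint (Filter.Eventually.of_forall hpos)] at key
  have hA := Real.rpow_nonneg (hJ g) ((p - 2) / p)
  have hB := Real.rpow_nonneg (hJ f) (1 / p)
  have hD := Real.rpow_nonneg (hJ h) (1 / p)
  rw [ENNReal.ofReal_le_ofReal_iff (by positivity)] at key
  refine key.trans (le_of_eq ?_)
  unfold _root_.lpNorm
  rw [← Real.rpow_mul (hJ g), mul_assoc]
  congr 3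
  ring

theorem gradient_sq_interpolation (p : ℝ) (hp : 2 ≤ p) :
    ∃ C : ℝ, 0 < C ∧ ∀ n : ℕ, 1 ≤ n →
      ∀ u : EuclideanSpace ℝ (Fin n) → ℝ,
        ContDiff ℝ (⊤ : ℕ∞) u → HasCompactSupport u →
        lpNorm p (gradNorm u) ^ 2 ≤
          C * lpNorm p u * (lpNorm p (lap u) + (p - 2) * lpNorm p (hessNorm u)) := by
  refine ⟨1, one_pos, fun n _ u hu hs => ?_⟩
  have hp0 : 0 < p := by linarith
  have hp2 : 0 ≤ p - 2 := by linarith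
  have hJ : ∀ k : EuclideanSpace ℝ (Fin n) → ℝ, 0 ≤ ∫ x, |k x| ^ p := fun k =>
    integral_nonneg fun x => Real.rpow_nonneg (abs_nonneg _) _
  have hN : ∀ k : EuclideanSpace ℝ (Fin n) → ℝ, 0 ≤ lpNorm p k := fun k =>
    Real.rpow_nonneg (hJ k) _
  have hg2 : ∀ x, gsq u x = |gradNorm u x| ^ (2 : ℝ) := fun x => by
    rw [Real.rpow_two, sq_abs, show gradNorm u x = Real.sqrt (gsq u x) from rfl, Real.sq_sqrt (gsq_nonneg u x)]
  have hgr : ∀ x, gsq u x ^ ((p - 2) / 2) = |gradNorm u x| ^ (p - 2) := fun x => by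
    rw [hg2, ← Real.rpow_mul (abs_nonneg _)]; congr 1; ring
  have hgp : ∀ x, gsq u x ^ ((p - 2) / 2) * gsq u x = |gradNorm u x| ^ p := fun x => by
    rw [hgr, hg2, ← Real.rpow_add_of_nonneg (abs_nonneg _) hp2 (by norm_num)]
    congr 1; ring
  have hint : ∀ h : EuclideanSpace ℝ (Fin n) → ℝ, Continuous h →
      Integrable (fun x => |gradNorm u x| ^ (p - 2) * (|u x| * |h x|)) := fun h hh => by
    refine Continuous.integrable_of_hasCompactSupport
      (((aux_grad_cont hu).abs.rpow_const fun x => Or.inr hp2).mul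
        (hu.continuous.abs.mul hh.abs)) ?_
    exact HasCompactSupport.mul_left (HasCompactSupport.mul_right
      (hs.comp_left (g := fun t : ℝ => |t|) abs_zero))
  have main := aux_main hu hs ((p - 2) / 2) (by linarith)
  simp only [hgp] at main
  simp only [hgr] at main
  have e : ∀ x, |gradNorm u x| ^ (p - 2) * (|u x| * (|lap u x| + 2 * ((p - 2) / 2) * hessNorm u x))
      = |gradNorm u x| ^ (p - 2) * (|u x| * |lap u x|) +
        (p - 2) * (|gradNorm u x| ^ (p - 2) * (|u x| * |hessNorm u x|)) := fun x => by
    rw [abs_of_nonneg (show 0 ≤ hessNorm u x from Real.sqrt_nonneg _)]; ring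
  simp only [e] at main
  rw [integral_add (hint _ (aux_lap_cont hu)) ((hint _ (aux_hess_cont hu)).const_mul _),
    integral_const_mul] at main
  have h1 := aux_holder p hp hu.continuous hs (aux_grad_cont hu) (aux_grad_supp hs)
    (aux_lap_cont hu) (aux_lap_supp hs)
  have h2 := aux_holder p hp hu.continuous hs (aux_grad_cont hu) (aux_grad_supp hs)
    (aux_hess_cont hu) (aux_hess_supp hs)
  have hA : ∫ x, |gradNorm u x| ^ p = lpNorm p (gradNorm u) ^ p := by
    unfold _root_.lpNorm
    rw [← Real.rpow_mul (hJ _), one_div_mul_cancel hp0.ne', Real.rpow_one]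
  rw [hA] at main
  have hR : 0 ≤ lpNorm p u * (lpNorm p (lap u) + (p - 2) * lpNorm p (hessNorm u)) :=
    mul_nonneg (hN _) (add_nonneg (hN _) (mul_nonneg hp2 (hN _)))
  rw [one_mul]
  rcases (hN (gradNorm u)).eq_or_lt with h0 | h0
  · rw [← h0]; simpa using hR
  · have hpw : 0 < lpNorm p (gradNorm u) ^ (p - 2) := Real.rpow_pos_of_pos h0 _
    refine le_of_mul_le_mul_left ?_ hpw
    have e2 : lpNorm p (gradNorm u) ^ p =
        lpNorm p (gradNorm u) ^ (p - 2) * lpNorm p (gradNorm u) ^ 2 := by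
      rw [← Real.rpow_two, ← Real.rpow_add h0]; congr 1; ring
    rw [← e2]
    have h3 := mul_le_mul_of_nonneg_left h2 hp2
    nlinarith [main, h1, h3]
end
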